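/- Assume that every even integer at least 8 is the sum of two distinct primes. Then for every odd positive integer n, the set {m ∈ ℕ : m ≥ 1 and there exist integers j, k ≥ 0 with s^[j](m) = s^[k](n)} is infinite (here s^[k] denotes the k-fold iterate of s). -/

import Mathlib

/-- The sum of all positive divisors of `n`. -/
def sigma (n : ℕ) : ℕ := ∑ d ∈ n.divisors, d

/-- The sum of the proper divisors of `n`. -/
def s (n : ℕ) : ℕ := sigma n - n

theorem s_prime {p : ℕ} (hp : p.Prime) : s p = 1 := by
  rw [s, sigma, hp.sum_divisors, Nat.add_sub_cancel_left]

theorem s_mul_primes {p q : ℕ} (hp : p.Prime) (hq : q.Prime) (hpq : p ≠ q) :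
    s (p * q) = p + q + 1 := by
  have hσ : sigma (p * q) = (p + 1) * (q + 1) := by
    have hcop : p.Coprime q := (Nat.coprime_primes hp hq).2 hpq
    rw [sigma, hcop.sum_divisors_mul, hp.sum_divisors, hq.sum_divisors]
  rw [s, hσ, Nat.sub_eq_iff_eq_add (by nlinarith)]
  ring

/-- Under Goldbach's conjecture for distinct primes, every odd `n ≥ 9` is `s m` for some larger
odd `m`. -/
theorem exists_odd_gt_s_eq
    (hG : ∀ N : ℕ, Even N → 8 ≤ N → ∃ p q : ℕ, p.Prime ∧ q.Prime ∧ p ≠ q ∧ N = p + q)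
    {n : ℕ} (hn : Odd n) (h9 : 9 ≤ n) : ∃ m, Odd m ∧ n < m ∧ s m = n := by
  obtain ⟨p, q, hp, hq, hpq, hsum⟩ := hG (n - 1) (Nat.Odd.sub_odd hn odd_one) (by omega)
  obtain ⟨a, ha⟩ := hn
  have hp2 := hp.two_le
  have hq2 := hq.two_le
  have hpo : Odd p := hp.eq_two_or_odd'.resolve_left fun h =>
    hq.eq_two_or_odd'.elim (by omega) fun ⟨b, hb⟩ => by omega
  have hqo : Odd q := hq.eq_two_or_odd'.resolve_left fun h => by
    obtain ⟨b, hb⟩ := hpo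
    omega
  have hp3 : 3 ≤ p := by
    obtain ⟨b, hb⟩ := hpo
    omega
  have hq3 : 3 ≤ q := by
    obtain ⟨b, hb⟩ := hqo
    omega
  refine ⟨p * q, hpo.mul hqo, ?_, ?_⟩
  · have hn' : n = p + q + 1 := by omega
    nlinarith
  · rw [s_mul_primes hp hq hpq]
    omega

theorem exists_ge_iterate_s_eq
    (hG : ∀ N : ℕ, Even N → 8 ≤ N → ∃ p q : ℕ, p.Prime ∧ q.Prime ∧ p ≠ q ∧ N = p + q)
    {n : ℕ} (hn : Odd n) (h9 : 9 ≤ n) (N : ℕ) :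
    ∃ m, Odd m ∧ n ≤ m ∧ N ≤ m ∧ ∃ j, s^[j] m = n := by
  induction N with
  | zero => exact ⟨n, hn, le_rfl, Nat.zero_le n, 0, rfl⟩
  | succ N ih =>
    obtain ⟨m, hm, hnm, hNm, j, hj⟩ := ih
    obtain ⟨m', hm', hlt, hs⟩ := exists_odd_gt_s_eq hG hm (h9.trans hnm)
    refine ⟨m', hm', by omega, by omega, j + 1, ?_⟩
    rw [Function.iterate_succ_apply, hs, hj]

theorem connected_component_infinite_of_goldbach
    (hG : ∀ N : ℕ, Even N → 8 ≤ N → ∃ p q : ℕ, p.Prime ∧ q.Prime ∧ p ≠ q ∧ N = p + q)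
    (n : ℕ) (hn : Odd n) (hn0 : 0 < n) :
    {m : ℕ | 1 ≤ m ∧ ∃ j k : ℕ, s^[j] m = s^[k] n}.Infinite := by
  rcases Nat.lt_or_ge n 9 with h | h9
  · have hk : ∃ k, s^[k] n = 1 := by
      obtain rfl | hp : n = 1 ∨ n.Prime := by
        interval_cases n <;> revert hn <;> decide
      · exact ⟨0, rfl⟩
      · exact ⟨1, s_prime hp⟩
    obtain ⟨k, hk⟩ := hk
    exact Nat.infinite_setOfPred_prime.mono fun p hp =>
      ⟨Nat.Prime.one_le hp, 1, k, (s_prime hp).trans hk.symm⟩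
  · refine Set.infinite_of_forall_exists_gt fun N => ?_
    obtain ⟨m, -, hnm, hNm, j, hj⟩ := exists_ge_iterate_s_eq hG hn h9 (N + 1)
    exact ⟨m, ⟨by omega, j, 0, hj⟩, hNm⟩
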